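/- Let W = (X, Y, Z, q_{Z|X,Y}) be a channel with finite alphabets, and let q_X, q_Y be input distributions with induced output distribution q_Z. Suppose R1 > I(X;Z|Y) and R2 > I(Y;Z). Then there exist γ1, γ2 > 0 such that for all sufficiently large block lengths n, the random codebooks of block length n and rates R1 and R2 satisfy P_{C1,C2}( ||p_{Z^n|C1,C2} − q_{Z^n}|| > exp(−γ1 n) ) ≤ exp(−exp(γ2 n)). -/

import Mathlib

open scoped BigOperators Classical

noncomputable section

namespace MACResolvability

/-- A multiple-access channel with finite input alphabets `X`, `Y`, finite output
alphabet `Z`, channel transition probabilities `W` and input distributions `qX`, `qY`. -/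
structure Channel (X Y Z : Type) [Fintype X] [Fintype Y] [Fintype Z] where
  W : X → Y → Z → ℝ
  qX : X → ℝ
  qY : Y → ℝ
  W_nonneg : ∀ x y z, 0 ≤ W x y z
  W_sum_one : ∀ x y, ∑ z, W x y z = 1
  qX_nonneg : ∀ x, 0 ≤ qX x
  qX_sum_one : ∑ x, qX x = 1
  qY_nonneg : ∀ y, 0 ≤ qY y
  qY_sum_one : ∑ y, qY y = 1

/-- Number of codewords of a codebook of block length `n` and rate `R` : `exp (n R)`. -/
def numCw (n : ℕ) (R : ℝ) : ℕ := ⌈Real.exp ((n : ℝ) * R)⌉₊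

/-- Variational distance between two (mass) functions on a finite set. -/
def tvDist {α : Type} [Fintype α] (p q : α → ℝ) : ℝ := (1 / 2) * ∑ a, |p a - q a|

/-- The standard normal cumulative distribution function `Φ`. -/
def stdNormalCDF (a : ℝ) : ℝ :=
  ∫ x in Set.Iic a, Real.exp (-(x ^ 2) / 2) / Real.sqrt (2 * Real.pi)

/-- The Gaussian tail function `Q = 1 - Φ`. -/
def Qfun (a : ℝ) : ℝ := 1 - stdNormalCDF a

/-- The inverse of the Gaussian tail function `Q` on `(0,1)`. -/
def Qinv (e : ℝ) : ℝ := Function.invFun Qfun e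

variable {X Y Z : Type} [Fintype X] [Fintype Y] [Fintype Z]

namespace Channel

variable (P : Channel X Y Z)

/-- Induced joint distribution `q_{X,Y,Z}`. -/
def joint (x : X) (y : Y) (z : Z) : ℝ := P.qX x * P.qY y * P.W x y z

/-- Output distribution `q_Z`. -/
def qZ (z : Z) : ℝ := ∑ x, ∑ y, P.joint x y z

/-- Conditional output distribution `q_{Z|Y}`. -/
def qZgY (y : Y) (z : Z) : ℝ := ∑ x, P.qX x * P.W x y z

/-- Conditional output distribution `q_{Z|X}`. -/
def qZgX (x : X) (z : Z) : ℝ := ∑ y, P.qY y * P.W x y z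

/-- Conditional information density `i(x; z | y)`. -/
def iXZgY (x : X) (y : Y) (z : Z) : ℝ := Real.log (P.W x y z / P.qZgY y z)

/-- Information density `i(y; z)`. -/
def iYZ (y : Y) (z : Z) : ℝ := Real.log (P.qZgY y z / P.qZ z)

/-- Information density `i(x; z)`. -/
def iXZ (x : X) (z : Z) : ℝ := Real.log (P.qZgX x z / P.qZ z)

/-- Conditional information density `i(y; z | x)`. -/
def iYZgX (x : X) (y : Y) (z : Z) : ℝ := Real.log (P.W x y z / P.qZgX x z)

/-- Conditional mutual information `I(X; Z | Y)`. -/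
def IXZgY : ℝ := ∑ x, ∑ y, ∑ z, P.joint x y z * P.iXZgY x y z

/-- Mutual information `I(Y; Z)`. -/
def IYZ : ℝ := ∑ x, ∑ y, ∑ z, P.joint x y z * P.iYZ y z

/-- Mutual information `I(X; Z)`. -/
def IXZ : ℝ := ∑ x, ∑ y, ∑ z, P.joint x y z * P.iXZ x z

/-- Conditional mutual information `I(Y; Z | X)`. -/
def IYZgX : ℝ := ∑ x, ∑ y, ∑ z, P.joint x y z * P.iYZgX x y z

/-- Central second moment of a per-letter function of `(X,Y,Z)` under the joint. -/
def centralMoment2 (f : X → Y → Z → ℝ) : ℝ :=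
  ∑ x, ∑ y, ∑ z, P.joint x y z *
    (f x y z - ∑ x', ∑ y', ∑ z', P.joint x' y' z' * f x' y' z') ^ 2

/-- Central absolute third moment of a per-letter function of `(X,Y,Z)` under the joint. -/
def absMoment3 (f : X → Y → Z → ℝ) : ℝ :=
  ∑ x, ∑ y, ∑ z, P.joint x y z *
    |f x y z - ∑ x', ∑ y', ∑ z', P.joint x' y' z' * f x' y' z'| ^ 3

/-- Central second moment of `i(X;Z|Y)`. -/
def V1 : ℝ := P.centralMoment2 P.iXZgY
/-- Central absolute third moment of `i(X;Z|Y)`. -/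
def Tm1 : ℝ := P.absMoment3 P.iXZgY
/-- Central second moment of `i(Y;Z)`. -/
def V2 : ℝ := P.centralMoment2 fun _ y z => P.iYZ y z
/-- Central absolute third moment of `i(Y;Z)`. -/
def Tm2 : ℝ := P.absMoment3 fun _ y z => P.iYZ y z
/-- Central second moment of `i(X;Z)`. -/
def VX : ℝ := P.centralMoment2 fun x _ z => P.iXZ x z
/-- Central absolute third moment of `i(X;Z)`. -/
def TmX : ℝ := P.absMoment3 fun x _ z => P.iXZ x z
/-- Central second moment of `i(Y;Z|X)`. -/
def VYgX : ℝ := P.centralMoment2 P.iYZgX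
/-- Central absolute third moment of `i(Y;Z|X)`. -/
def TmYgX : ℝ := P.absMoment3 P.iYZgX

/-- `n`-fold product channel `q_{Z^n | X^n, Y^n}`. -/
def Wn (n : ℕ) (xs : Fin n → X) (ys : Fin n → Y) (zs : Fin n → Z) : ℝ :=
  ∏ k, P.W (xs k) (ys k) (zs k)

/-- `n`-fold product output distribution `q_{Z^n}`. -/
def qZn (n : ℕ) (zs : Fin n → Z) : ℝ := ∏ k, P.qZ (zs k)

/-- `n`-fold product conditional distribution `q_{Z^n | Y^n}`. -/
def qZgYn (n : ℕ) (ys : Fin n → Y) (zs : Fin n → Z) : ℝ := ∏ k, P.qZgY (ys k) (zs k)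

/-- `n`-letter conditional information density `i(x^n; z^n | y^n)`. -/
def iXZgYn (n : ℕ) (xs : Fin n → X) (ys : Fin n → Y) (zs : Fin n → Z) : ℝ :=
  ∑ k, P.iXZgY (xs k) (ys k) (zs k)

/-- `n`-letter information density `i(y^n; z^n)`. -/
def iYZn (n : ℕ) (ys : Fin n → Y) (zs : Fin n → Z) : ℝ := ∑ k, P.iYZ (ys k) (zs k)

/-- The typical set `T1^n(ε)`. -/
def T1set (n : ℕ) (ε : ℝ) : Set ((Fin n → X) × (Fin n → Y) × (Fin n → Z)) :=
  {t | P.iXZgYn n t.1 t.2.1 t.2.2 ≤ (n : ℝ) * (P.IXZgY + ε)}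

/-- The typical set `T2^n(ε)`. -/
def T2set (n : ℕ) (ε : ℝ) : Set ((Fin n → Y) × (Fin n → Z)) :=
  {t | P.iYZn n t.1 t.2 ≤ (n : ℝ) * (P.IYZ + ε)}

/-- Probability of an event under the `n`-fold i.i.d. joint distribution `q_{X,Y,Z}^n`. -/
def jointPn (n : ℕ) (A : Set ((Fin n → X) × (Fin n → Y) × (Fin n → Z))) : ℝ :=
  ∑ xs : Fin n → X, ∑ ys : Fin n → Y, ∑ zs : Fin n → Z,
    (∏ k, P.joint (xs k) (ys k) (zs k)) * (if (xs, ys, zs) ∈ A then 1 else 0)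

/-- Probability of an event of `(Y^n, Z^n)` under the `n`-fold i.i.d. joint distribution. -/
def jointPYZn (n : ℕ) (A : Set ((Fin n → Y) × (Fin n → Z))) : ℝ :=
  ∑ xs : Fin n → X, ∑ ys : Fin n → Y, ∑ zs : Fin n → Z,
    (∏ k, P.joint (xs k) (ys k) (zs k)) * (if (ys, zs) ∈ A then 1 else 0)

/-- Probability of an event of the pair of random codebooks, each component of each codeword
drawn i.i.d. according to `qX` resp. `qY`. -/
def cbP2 (n M1 M2 : ℕ)
    (E : (Fin M1 → Fin n → X) → (Fin M2 → Fin n → Y) → Prop) : ℝ :=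
  ∑ C1 : Fin M1 → Fin n → X, ∑ C2 : Fin M2 → Fin n → Y,
    ((∏ m, ∏ k, P.qX (C1 m k)) * (∏ m, ∏ k, P.qY (C2 m k))) *
      (if E C1 C2 then 1 else 0)

/-- Probability of an event of the random codebook `C1`. -/
def cbP1 (n M1 : ℕ) (E : (Fin M1 → Fin n → X) → Prop) : ℝ :=
  ∑ C1 : Fin M1 → Fin n → X,
    (∏ m, ∏ k, P.qX (C1 m k)) * (if E C1 then 1 else 0)

/-- Expectation of a function of the pair of random codebooks. -/
def cbE2 (n M1 M2 : ℕ)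
    (f : (Fin M1 → Fin n → X) → (Fin M2 → Fin n → Y) → ℝ) : ℝ :=
  ∑ C1 : Fin M1 → Fin n → X, ∑ C2 : Fin M2 → Fin n → Y,
    ((∏ m, ∏ k, P.qX (C1 m k)) * (∏ m, ∏ k, P.qY (C2 m k))) * f C1 C2

/-- The output distribution `p_{Z^n | C1, C2}` induced by the codebooks `C1`, `C2`. -/
def pOut (n : ℕ) (R1 R2 : ℝ) {M1 M2 : ℕ}
    (C1 : Fin M1 → Fin n → X) (C2 : Fin M2 → Fin n → Y) (zs : Fin n → Z) : ℝ :=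
  Real.exp (-((n : ℝ) * (R1 + R2))) * ∑ m1, ∑ m2, P.Wn n (C1 m1) (C2 m2) zs

/-- The atypical term `P_atyp,1` for a typical set `T1`. -/
def Patyp1 (n : ℕ) (R1 R2 : ℝ) {M1 M2 : ℕ}
    (C1 : Fin M1 → Fin n → X) (C2 : Fin M2 → Fin n → Y)
    (T1 : Set ((Fin n → X) × (Fin n → Y) × (Fin n → Z))) : ℝ :=
  ∑ zs : Fin n → Z, Real.exp (-((n : ℝ) * (R1 + R2))) *
    ∑ m1, ∑ m2, P.Wn n (C1 m1) (C2 m2) zs *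
      (if (C1 m1, C2 m2, zs) ∈ T1 then 0 else 1)

/-- The atypical term `P_atyp,2` for a typical set `T2`. -/
def Patyp2 (n : ℕ) (R1 R2 : ℝ) {M1 M2 : ℕ}
    (C1 : Fin M1 → Fin n → X) (C2 : Fin M2 → Fin n → Y)
    (T2 : Set ((Fin n → Y) × (Fin n → Z))) : ℝ :=
  ∑ zs : Fin n → Z, Real.exp (-((n : ℝ) * (R1 + R2))) *
    ∑ m1, ∑ m2, P.Wn n (C1 m1) (C2 m2) zs *
      (if (C2 m2, zs) ∈ T2 then 0 else 1)

/-- The typical term `T_typ(z^n)`. -/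
def Ttyp (n : ℕ) (R1 R2 : ℝ) {M1 M2 : ℕ}
    (C1 : Fin M1 → Fin n → X) (C2 : Fin M2 → Fin n → Y)
    (T1 : Set ((Fin n → X) × (Fin n → Y) × (Fin n → Z)))
    (T2 : Set ((Fin n → Y) × (Fin n → Z))) (zs : Fin n → Z) : ℝ :=
  ∑ m1, ∑ m2, Real.exp (-((n : ℝ) * (R1 + R2))) *
    (P.Wn n (C1 m1) (C2 m2) zs / P.qZn n zs) *
    (if (C2 m2, zs) ∈ T2 then 1 else 0) *
    (if (C1 m1, C2 m2, zs) ∈ T1 then 1 else 0)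

/-- The typical term `T_typ,1(y^n, z^n)` of the first codebook. -/
def Ttyp1 (n : ℕ) (R1 : ℝ) {M1 : ℕ} (C1 : Fin M1 → Fin n → X)
    (ys : Fin n → Y) (zs : Fin n → Z)
    (T1 : Set ((Fin n → X) × (Fin n → Y) × (Fin n → Z))) : ℝ :=
  ∑ m1, Real.exp (-((n : ℝ) * R1)) *
    (P.Wn n (C1 m1) ys zs / P.qZgYn n ys zs) *
    (if (C1 m1, ys, zs) ∈ T1 then 1 else 0)

end Channel

/-! ### Generic finite probability -/

def Ex {A : Type} [Fintype A] (p f : A → ℝ) : ℝ := ∑ a, p a * f a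

structure IsPmf {A : Type} [Fintype A] (p : A → ℝ) : Prop where
  nonneg : ∀ a, 0 ≤ p a
  sum_one : ∑ a, p a = 1

def pw {A : Type} (p : A → ℝ) (M : ℕ) (C : Fin M → A) : ℝ := ∏ m, p (C m)

lemma pw_pos_iff {A : Type} {p : A → ℝ} (M : ℕ) (C : Fin M → A) :
    pw p M C ≠ 0 ↔ ∀ m, p (C m) ≠ 0 := by
  simp [pw, Finset.prod_ne_zero_iff]

section Generic

variable {A B D : Type} [Fintype A] [Fintype B] [Fintype D]

lemma Ex_mono {p f g : A → ℝ} (hp : IsPmf p) (h : ∀ a, p a ≠ 0 → f a ≤ g a) : Ex p f ≤ Ex p g := by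
  refine Finset.sum_le_sum fun a _ => ?_
  by_cases h0 : p a = 0
  · simp [h0]
  · exact mul_le_mul_of_nonneg_left (h a h0) (hp.nonneg a)

lemma Ex_const {p : A → ℝ} (hp : IsPmf p) (c : ℝ) : Ex p (fun _ => c) = c := by
  simp [Ex, ← Finset.sum_mul, hp.sum_one]

lemma Ex_add (p f g : A → ℝ) : Ex p (fun a => f a + g a) = Ex p f + Ex p g := by
  simp [Ex, mul_add, Finset.sum_add_distrib]

lemma Ex_sub (p f g : A → ℝ) : Ex p (fun a => f a - g a) = Ex p f - Ex p g := by
  simp [Ex, mul_sub, Finset.sum_sub_distrib]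

lemma Ex_const_mul (p f : A → ℝ) (c : ℝ) : Ex p (fun a => c * f a) = c * Ex p f := by
  simp only [Ex, Finset.mul_sum]
  exact Finset.sum_congr rfl fun a _ => by ring

lemma Ex_mul_const (p f : A → ℝ) (c : ℝ) : Ex p (fun a => f a * c) = Ex p f * c := by
  simp only [Ex, Finset.sum_mul]
  exact Finset.sum_congr rfl fun a _ => by ring

lemma Ex_sum {ι : Type} (s : Finset ι) (p : A → ℝ) (f : ι → A → ℝ) :
    Ex p (fun a => ∑ i ∈ s, f i a) = ∑ i ∈ s, Ex p (f i) := by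
  simp only [Ex, Finset.mul_sum]
  exact Finset.sum_comm

lemma Ex_comm (p : A → ℝ) (q : B → ℝ) (f : A → B → ℝ) :
    Ex p (fun a => Ex q (fun b => f a b)) = Ex q (fun b => Ex p (fun a => f a b)) := by
  simp only [Ex, Finset.mul_sum]
  rw [Finset.sum_comm]
  exact Finset.sum_congr rfl fun a _ => Finset.sum_congr rfl fun b _ => by ring

lemma Ex_nonneg {p f : A → ℝ} (hp : IsPmf p) (h : ∀ a, 0 ≤ f a) : 0 ≤ Ex p f :=
  Finset.sum_nonneg fun a _ => mul_nonneg (hp.nonneg a) (h a)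


lemma Ex_pw_succ (p : A → ℝ) (M : ℕ) (F : (Fin (M+1) → A) → ℝ) :
    Ex (pw p (M+1)) F = Ex p (fun a => Ex (pw p M) (fun C => F (Fin.cons a C))) := by
  simp only [Ex, Finset.mul_sum]
  rw [← Fintype.sum_prod_type' (f := fun a C => p a * (pw p M C * F (Fin.cons a C)))]
  refine (Fintype.sum_equiv (Fin.consEquiv (fun _ => A)) _ _ ?_).symm
  rintro ⟨a, C⟩
  simp [pw, Fin.prod_univ_succ, Fin.consEquiv, mul_assoc]

lemma Ex_pw_zero (p : A → ℝ) (F : (Fin 0 → A) → ℝ) : Ex (pw p 0) F = F Fin.elim0 := by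
  simp only [Ex, pw]
  rw [Fintype.sum_unique]
  simp
  congr 1

lemma pw_isPmf {p : A → ℝ} (hp : IsPmf p) (M : ℕ) : IsPmf (pw p M) := by
  refine ⟨fun C => Finset.prod_nonneg fun m _ => hp.nonneg _, ?_⟩
  have : ∀ M, Ex (pw p M) (fun _ => 1) = 1 := by
    intro M
    induction M with
    | zero => rw [Ex_pw_zero]
    | succ M ih => rw [Ex_pw_succ]; simp only [ih]; exact Ex_const hp 1
  simpa [Ex] using this M

lemma Ex_pw_eval {p : A → ℝ} (hp : IsPmf p) (M : ℕ) (m : Fin M) (f : A → ℝ) :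
    Ex (pw p M) (fun C => f (C m)) = Ex p f := by
  induction M with
  | zero => exact m.elim0
  | succ M ih =>
    rw [Ex_pw_succ]
    refine Fin.cases ?_ (fun m => ?_) m
    · simp [Ex_const (pw_isPmf hp M)]
    · simp [ih, Ex_const hp]

lemma Ex_pw_sum_sq {p : A → ℝ} (hp : IsPmf p) (M : ℕ) (g : A → ℝ) (hg : Ex p g = 0) :
    Ex (pw p M) (fun C => (∑ m, g (C m)) ^ 2) = M * Ex p (fun a => g a ^ 2) := by
  induction M with
  | zero => simp [Ex_pw_zero]
  | succ M ih =>
    rw [Ex_pw_succ]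
    have h0 : Ex (pw p M) (fun C => ∑ m, g (C m)) = 0 := by
      rw [Ex_sum]; simp [Ex_pw_eval hp, hg]
    have : ∀ a, Ex (pw p M) (fun C => (∑ m, g ((Fin.cons a C : Fin (M+1) → A) m)) ^ 2)
        = g a ^ 2 + M * Ex p (fun a => g a ^ 2) := by
      intro a
      have e : (fun C : Fin M → A => (∑ m, g ((Fin.cons a C : Fin (M+1) → A) m)) ^ 2) =
        fun C => g a ^ 2 + (2 * g a * (∑ m, g (C m)) + (∑ m, g (C m)) ^ 2) := by
        funext C
        rw [Fin.sum_univ_succ]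
        simp
        ring
      rw [e, Ex_add, Ex_add, Ex_const_mul, h0, ih, Ex_const (pw_isPmf hp M)]
      ring
    simp only [this]
    rw [Ex_add, Ex_const hp]
    push_cast; ring

lemma Ex_abs_le_sqrt {p : A → ℝ} (hp : IsPmf p) (f : A → ℝ) :
    Ex p (fun a => |f a|) ≤ Real.sqrt (Ex p (fun a => f a ^ 2)) := by
  apply Real.le_sqrt_of_sq_le
  set μ := Ex p (fun a => |f a|) with hμ
  have h := Ex_nonneg hp (f := fun a => (|f a| - μ) ^ 2) (fun a => sq_nonneg _)
  have e : (fun a => (|f a| - μ) ^ 2) = fun a => (f a ^ 2 - (2 * μ) * |f a|) + μ ^ 2 := by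
    funext a; rw [sub_sq, sq_abs]; ring
  rw [e, Ex_add, Ex_sub, Ex_const_mul, Ex_const hp, ← hμ] at h
  nlinarith

/-- one-variable Hoeffding-type bound -/
lemma mgf_one {p : A → ℝ} (hp : IsPmf p) (G : A → ℝ) (c : ℝ) (hc : c ≤ 1)
    (hG : ∀ a a', |G a - G a'| ≤ c) :
    Ex p (fun a => Real.exp (G a)) ≤ Real.exp (Ex p G + c ^ 2) := by
  set μ := Ex p G with hμ
  have hdev : ∀ a, |G a - μ| ≤ c := by
    intro a
    have e : G a - μ = Ex p (fun a' => G a - G a') := by rw [Ex_sub, Ex_const hp]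
    rw [e, abs_le]
    constructor
    · rw [← Ex_const hp (-c)]
      exact Ex_mono hp fun a' _ => (abs_le.1 (hG a a')).1
    · rw [← Ex_const hp c]
      exact Ex_mono hp fun a' _ => (abs_le.1 (hG a a')).2
  have key : ∀ a, Real.exp (G a) ≤ Real.exp μ * ((1 + c ^ 2 - μ) + G a) := by
    intro a
    have h1 := Real.abs_exp_sub_one_sub_id_le ((hdev a).trans hc)
    have h2 : (G a - μ) ^ 2 ≤ c ^ 2 := sq_le_sq' (abs_le.1 (hdev a)).1 (abs_le.1 (hdev a)).2
    have h3 := (abs_le.1 h1).2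
    have : Real.exp (G a) = Real.exp μ * Real.exp (G a - μ) := by rw [← Real.exp_add]; ring_nf
    rw [this]
    exact mul_le_mul_of_nonneg_left (by linarith) (Real.exp_nonneg _)
  calc Ex p (fun a => Real.exp (G a)) ≤ Ex p (fun a => Real.exp μ * ((1 + c ^ 2 - μ) + G a)) :=
        Ex_mono hp fun a _ => key a
    _ = Real.exp μ * (1 + c ^ 2) := by
        rw [Ex_const_mul, Ex_add, Ex_const hp, ← hμ]; ring
    _ ≤ Real.exp μ * Real.exp (c ^ 2) := by
        apply mul_le_mul_of_nonneg_left _ (Real.exp_nonneg _)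
        linarith [Real.add_one_le_exp (c ^ 2)]
    _ = _ := by rw [← Real.exp_add]

lemma abs_Ex_sub_le {p : A → ℝ} (hp : IsPmf p) {f g : A → ℝ} {c : ℝ}
    (h : ∀ a, |f a - g a| ≤ c) : |Ex p f - Ex p g| ≤ c := by
  rw [← Ex_sub, abs_le]
  constructor
  · rw [← Ex_const hp (-c)]
    exact Ex_mono hp fun a _ => (abs_le.1 (h a)).1
  · rw [← Ex_const hp c]
    exact Ex_mono hp fun a _ => (abs_le.1 (h a)).2

/-- McDiarmid-type bound on the moment generating function. -/
lemma mgf_pw {p : A → ℝ} (hp : IsPmf p) (c : ℝ) (hc : c ≤ 1) (M : ℕ) (F : (Fin M → A) → ℝ)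
    (hF : ∀ C m a, |F (Function.update C m a) - F C| ≤ c) :
    Ex (pw p M) (fun C => Real.exp (F C)) ≤ Real.exp (Ex (pw p M) F + M * c ^ 2) := by
  induction M with
  | zero => simp [Ex_pw_zero]
  | succ M ih =>
    rw [Ex_pw_succ, Ex_pw_succ]
    set G : A → ℝ := fun a => Ex (pw p M) (fun C => F (Fin.cons a C)) with hGd
    have h1 : ∀ a, Ex (pw p M) (fun C => Real.exp (F (Fin.cons a C)))
        ≤ Real.exp (G a) * Real.exp (M * c ^ 2) := by
      intro a
      rw [← Real.exp_add]
      refine ih (fun C => F (Fin.cons a C)) fun C m a' => ?_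
      have := hF (Fin.cons a C) m.succ a'
      rwa [← Fin.cons_update] at this
    have h2 : ∀ a a', |G a - G a'| ≤ c := by
      intro a a'
      refine abs_Ex_sub_le (pw_isPmf hp M) fun C => ?_
      have := hF (Fin.cons a' C) 0 a
      rwa [Fin.update_cons_zero] at this
    calc _ ≤ Ex p (fun a => Real.exp (G a) * Real.exp (M * c ^ 2)) := Ex_mono hp fun a _ => h1 a
      _ ≤ Real.exp (Ex p G + c ^ 2) * Real.exp (M * c ^ 2) := by
        rw [Ex_mul_const]
        exact mul_le_mul_of_nonneg_right (mgf_one hp G c hc h2) (Real.exp_nonneg _)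
      _ = _ := by rw [← Real.exp_add]; push_cast; ring_nf

lemma Ex_pw_prod (p f : A → ℝ) (n : ℕ) :
    Ex (pw p n) (fun a => ∏ k, f (a k)) = (Ex p f) ^ n := by
  induction n with
  | zero => simp [Ex_pw_zero]
  | succ n ih =>
    rw [Ex_pw_succ]
    simp only [Fin.prod_univ_succ, Fin.cons_zero, Fin.cons_succ, Ex_const_mul, ih]
    rw [Ex_mul_const, pow_succ, mul_comm]

/-- Chernoff bound. -/
lemma chernoff {p : A → ℝ} (hp : IsPmf p) (f : A → ℝ) {ε : ℝ} (hε : 0 < ε) :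
    ∃ δ > (0:ℝ), ∀ n : ℕ, Ex (pw p n)
      (fun a => if (∑ k, f (a k)) ≤ n * (Ex p f + ε) then (0:ℝ) else 1) ≤ Real.exp (-(δ * n)) := by
  obtain ⟨c, hc1, hc⟩ : ∃ c : ℝ, 1 ≤ c ∧ ∀ a a', |f a - f a'| ≤ c := by
    refine ⟨1 + 2 * ∑ a, |f a|, ?_, fun a a' => ?_⟩
    · linarith [Finset.sum_nonneg (s := Finset.univ) fun a _ => abs_nonneg (f a)]
    · have h1 := Finset.single_le_sum (f := fun a => |f a|) (fun a _ => abs_nonneg _) (Finset.mem_univ a)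
      have h2 := Finset.single_le_sum (f := fun a => |f a|) (fun a _ => abs_nonneg _) (Finset.mem_univ a')
      have h3 := abs_sub (f a) (f a')
      linarith
  set l : ℝ := min (1 / c) (ε / (2 * c ^ 2)) with hl
  have hc0 : 0 < c := by linarith
  have hl0 : 0 < l := by rw [hl]; positivity
  have hlc : l * c ≤ 1 := by
    have : l ≤ 1 / c := min_le_left _ _
    rwa [le_div_iff₀ hc0] at this
  have hlc2 : l * c ^ 2 ≤ ε / 2 := by
    have : l ≤ ε / (2 * c ^ 2) := min_le_right _ _
    rw [le_div_iff₀ (by positivity)] at this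
    linarith
  refine ⟨l * ε / 2, by positivity, fun n => ?_⟩
  set μ := Ex p f with hμ
  have hone : Ex p (fun a => Real.exp (l * f a)) ≤ Real.exp (l * μ + (l * c) ^ 2) := by
    have := mgf_one hp (fun a => l * f a) (l * c) hlc (fun a a' => by
      rw [← mul_sub, abs_mul, abs_of_pos hl0]; exact mul_le_mul_of_nonneg_left (hc a a') hl0.le)
    rwa [Ex_const_mul] at this
  calc _ ≤ Ex (pw p n) (fun a => Real.exp (-(l * (n * (μ + ε)))) * ∏ k, Real.exp (l * f (a k))) := by
        refine Ex_mono (pw_isPmf hp n) fun a _ => ?_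
        rw [← Real.exp_sum, ← Finset.mul_sum, ← Real.exp_add]
        split_ifs with h
        · positivity
        · apply Real.one_le_exp
          have := mul_le_mul_of_nonneg_left (not_le.1 h).le hl0.le
          linarith
    _ = Real.exp (-(l * (n * (μ + ε)))) * (Ex p (fun a => Real.exp (l * f a))) ^ n := by
        rw [Ex_const_mul, Ex_pw_prod p (fun a => Real.exp (l * f a))]
    _ ≤ Real.exp (-(l * (n * (μ + ε)))) * (Real.exp (l * μ + (l * c) ^ 2)) ^ n := by
        apply mul_le_mul_of_nonneg_left _ (Real.exp_nonneg _)
        exact pow_le_pow_left₀ (Ex_nonneg hp fun a => Real.exp_nonneg _) hone n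
    _ ≤ _ := by
        rw [← Real.exp_nat_mul, ← Real.exp_add]
        apply Real.exp_le_exp.2
        have : (n:ℝ) * (l * (l * c ^ 2)) ≤ n * (l * (ε / 2)) := by gcongr
        nlinarith

/-- One-shot soft covering in expectation. -/
lemma cover {p : A → ℝ} (hp : IsPmf p) (v vT : A → D → ℝ) (hT0 : ∀ a d, 0 ≤ vT a d)
    (hTv : ∀ a d, vT a d ≤ v a d) (K : ℝ) (hK : 0 ≤ K)
    (hKb : ∀ a d, p a ≠ 0 → vT a d ≤ K * Ex p (fun a => v a d)) (M : ℕ) (hM : 0 < M) :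
    Ex (pw p M) (fun C => ∑ d, |(M:ℝ)⁻¹ * ∑ m, v (C m) d - Ex p (fun a => v a d)|)
      ≤ Real.sqrt (K / M) * (∑ d, Ex p (fun a => v a d))
        + 2 * Ex p (fun a => ∑ d, (v a d - vT a d)) := by
  have hMr : (0:ℝ) < M := by exact_mod_cast hM
  have hpw := pw_isPmf hp M
  rw [Ex_sum, Ex_sum, Finset.mul_sum, Finset.mul_sum, ← Finset.sum_add_distrib]
  refine Finset.sum_le_sum fun d _ => ?_
  set r := Ex p (fun a => v a d) with hr
  set rT := Ex p (fun a => vT a d) with hrT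
  have hr0 : 0 ≤ r := Ex_nonneg hp fun a => (hT0 a d).trans (hTv a d)
  have hrTr : rT ≤ r := Ex_mono hp fun a _ => hTv a d
  have hrT0 : 0 ≤ rT := Ex_nonneg hp fun a => hT0 a d
  have hA : Ex p (fun a => v a d - vT a d) = r - rT := Ex_sub _ _ _
  rw [hA]
  set g : A → ℝ := fun a => vT a d - rT with hg
  have hg0 : Ex p g = 0 := by rw [hg, Ex_sub, Ex_const hp, hrT]; ring
  have hsq : Ex p (fun a => g a ^ 2) ≤ K * r ^ 2 := by
    have e : (fun a => g a ^ 2) = fun a => (vT a d * vT a d - (2 * rT) * vT a d) + rT ^ 2 := by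
      funext a; simp only [hg]; ring
    rw [e, Ex_add, Ex_sub, Ex_const_mul, Ex_const hp, ← hrT]
    have : Ex p (fun a => vT a d * vT a d) ≤ Ex p (fun a => (K * r) * vT a d) :=
      Ex_mono hp fun a ha => mul_le_mul_of_nonneg_right (hKb a d ha) (hT0 a d)
    rw [Ex_const_mul, ← hrT] at this
    have h2 : K * r * rT ≤ K * r * r := mul_le_mul_of_nonneg_left hrTr (by positivity)
    nlinarith [sq_nonneg rT]
  have hpt : ∀ C : Fin M → A, |(M:ℝ)⁻¹ * ∑ m, v (C m) d - r| ≤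
      (M:ℝ)⁻¹ * |∑ m, g (C m)| + ((M:ℝ)⁻¹ * ∑ m, (v (C m) d - vT (C m) d) + (r - rT)) := by
    intro C
    have e : (M:ℝ)⁻¹ * ∑ m, v (C m) d - r = (M:ℝ)⁻¹ * ∑ m, g (C m)
        + ((M:ℝ)⁻¹ * ∑ m, (v (C m) d - vT (C m) d) - (r - rT)) := by
      simp only [hg, Finset.sum_sub_distrib, Finset.sum_const, Finset.card_univ, Fintype.card_fin,
        nsmul_eq_mul]
      field_simp
      ring
    rw [e]
    have hs : 0 ≤ (M:ℝ)⁻¹ * ∑ m, (v (C m) d - vT (C m) d) :=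
      mul_nonneg (by positivity) (Finset.sum_nonneg fun m _ => sub_nonneg.2 (hTv _ _))
    refine (abs_add_le _ _).trans (add_le_add ?_ ?_)
    · rw [abs_mul, abs_of_pos (by positivity : (0:ℝ) < (M:ℝ)⁻¹)]
    · refine (abs_sub _ _).trans ?_
      rw [abs_of_nonneg hs, abs_of_nonneg (sub_nonneg.2 hrTr)]
  refine (Ex_mono hpw fun C _ => hpt C).trans ?_
  rw [Ex_add, Ex_add, Ex_const_mul, Ex_const_mul, Ex_const hpw, Ex_sum]
  simp only [Ex_pw_eval hp M _ (fun a => v a d - vT a d), hA]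
  have h1 : Ex (pw p M) (fun C => |∑ m, g (C m)|) ≤ Real.sqrt (M * (K * r ^ 2)) := by
    refine (Ex_abs_le_sqrt hpw _).trans (Real.sqrt_le_sqrt ?_)
    rw [Ex_pw_sum_sq hp M g hg0]
    exact mul_le_mul_of_nonneg_left hsq hMr.le
  have h2 : (M:ℝ)⁻¹ * Real.sqrt (M * (K * r ^ 2)) = Real.sqrt (K / M) * r := by
    have : (M:ℝ) * (K * r ^ 2) = (K / M) * (M * r) ^ 2 := by field_simp
    rw [this, Real.sqrt_mul (by positivity), Real.sqrt_sq (by positivity)]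
    field_simp
  have h3 : (M:ℝ)⁻¹ * Ex (pw p M) (fun C => |∑ m, g (C m)|) ≤ Real.sqrt (K / M) * r := by
    rw [← h2]; exact mul_le_mul_of_nonneg_left h1 (by positivity)
  have h4 : (M:ℝ)⁻¹ * ∑ i : Fin M, (r - rT) = r - rT := by
    simp; field_simp
  rw [h4]
  linarith

end Generic

section OneShot

variable {A B D : Type} [Fintype A] [Fintype B] [Fintype D]

def Fdev (w : A → B → D → ℝ) (s : D → ℝ) {M1 M2 : ℕ} (C1 : Fin M1 → A) (C2 : Fin M2 → B) : ℝ :=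
  ∑ d, |(M1:ℝ)⁻¹ * ∑ m1, ((M2:ℝ)⁻¹ * ∑ m2, w (C1 m1) (C2 m2) d) - s d|

lemma bdd_diff (v : A → D → ℝ) (hv0 : ∀ a d, 0 ≤ v a d) (hv1 : ∀ a, ∑ d, v a d = 1) (s : D → ℝ)
    {M : ℕ} (C : Fin M → A) (m : Fin M) (a : A) :
    |(∑ d, |(M:ℝ)⁻¹ * ∑ i, v (Function.update C m a i) d - s d|)
      - (∑ d, |(M:ℝ)⁻¹ * ∑ i, v (C i) d - s d|)| ≤ 2 / M := by
  have hsum : ∀ d, ∑ i, v (Function.update C m a i) d = ∑ i, v (C i) d + (v a d - v (C m) d) := by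
    intro d
    rw [← sub_eq_iff_eq_add', ← Finset.sum_sub_distrib, Finset.sum_eq_single m]
    · simp
    · intro i _ hi; simp [Function.update_of_ne hi]
    · simp
  rw [← Finset.sum_sub_distrib]
  refine (Finset.abs_sum_le_sum_abs _ _).trans ?_
  calc _ ≤ ∑ d, (M:ℝ)⁻¹ * (v a d + v (C m) d) := by
        refine Finset.sum_le_sum fun d _ => ?_
        refine (abs_abs_sub_abs_le_abs_sub _ _).trans ?_
        rw [hsum]
        have : (M:ℝ)⁻¹ * (∑ i, v (C i) d + (v a d - v (C m) d)) - s d -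
          ((M:ℝ)⁻¹ * ∑ i, v (C i) d - s d) = (M:ℝ)⁻¹ * (v a d - v (C m) d) := by ring
        rw [this, abs_mul, abs_of_nonneg (by positivity : (0:ℝ) ≤ (M:ℝ)⁻¹)]
        gcongr
        refine (abs_sub _ _).trans ?_
        rw [abs_of_nonneg (hv0 _ _), abs_of_nonneg (hv0 _ _)]
    _ = 2 / M := by
        rw [← Finset.mul_sum, Finset.sum_add_distrib, hv1, hv1]; ring

lemma avg_sum_one {M : ℕ} (hM : 0 < M) (v : Fin M → D → ℝ) (hv : ∀ m, ∑ d, v m d = 1) :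
    ∑ d, (M:ℝ)⁻¹ * ∑ m, v m d = 1 := by
  have hMr : (0:ℝ) < M := by exact_mod_cast hM
  rw [← Finset.mul_sum, Finset.sum_comm]
  simp [hv]
  field_simp

lemma mgf_two {p : A → ℝ} {q : B → ℝ} (hp : IsPmf p) (hq : IsPmf q)
    (w : A → B → D → ℝ) (hw0 : ∀ a b d, 0 ≤ w a b d) (hw1 : ∀ a b, ∑ d, w a b d = 1)
    (s : D → ℝ) {M1 M2 : ℕ} (hM1 : 0 < M1) (hM2 : 0 < M2) (l : ℝ) (hl : 0 ≤ l)
    (h1 : l * (2 / M1) ≤ 1) (h2 : l * (2 / M2) ≤ 1) :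
    Ex (pw p M1) (fun C1 => Ex (pw q M2) (fun C2 => Real.exp (l * Fdev w s C1 C2))) ≤
      Real.exp (l * Ex (pw p M1) (fun C1 => Ex (pw q M2) (fun C2 => Fdev w s C1 C2))
        + M1 * (l * (2 / M1)) ^ 2 + M2 * (l * (2 / M2)) ^ 2) := by
  have hM1r : (0:ℝ) < M1 := by exact_mod_cast hM1
  have hM2r : (0:ℝ) < M2 := by exact_mod_cast hM2
  have hd1 : ∀ (C1 : Fin M1 → A) (C2 : Fin M2 → B) m a,
      |Fdev w s (Function.update C1 m a) C2 - Fdev w s C1 C2| ≤ 2 / M1 := by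
    intro C1 C2 m a
    exact bdd_diff (fun a d => (M2:ℝ)⁻¹ * ∑ m2, w a (C2 m2) d)
      (fun a d => mul_nonneg (by positivity) (Finset.sum_nonneg fun i _ => hw0 _ _ _))
      (fun a => avg_sum_one hM2 (fun m2 d => w a (C2 m2) d) fun m2 => hw1 _ _) s C1 m a
  have hsymm : ∀ (C1 : Fin M1 → A) (C2 : Fin M2 → B), Fdev w s C1 C2 =
      ∑ d, |(M2:ℝ)⁻¹ * ∑ m2, ((M1:ℝ)⁻¹ * ∑ m1, w (C1 m1) (C2 m2) d) - s d| := by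
    intro C1 C2
    refine Finset.sum_congr rfl fun d _ => ?_
    congr 2
    rw [← Finset.mul_sum, ← Finset.mul_sum, Finset.sum_comm]
    ring
  have hd2 : ∀ (C1 : Fin M1 → A) (C2 : Fin M2 → B) m b,
      |Fdev w s C1 (Function.update C2 m b) - Fdev w s C1 C2| ≤ 2 / M2 := by
    intro C1 C2 m b
    rw [hsymm, hsymm]
    exact bdd_diff (fun b d => (M1:ℝ)⁻¹ * ∑ m1, w (C1 m1) b d)
      (fun b d => mul_nonneg (by positivity) (Finset.sum_nonneg fun i _ => hw0 _ _ _))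
      (fun b => avg_sum_one hM1 (fun m1 d => w (C1 m1) b d) fun m1 => hw1 _ _) s C2 m b
  have hscale : ∀ {u u' c : ℝ}, |u - u'| ≤ c → |l * u - l * u'| ≤ l * c := by
    intro u u' c h
    rw [← mul_sub, abs_mul, abs_of_nonneg hl]
    exact mul_le_mul_of_nonneg_left h hl
  set G : (Fin M1 → A) → ℝ := fun C1 => Ex (pw q M2) (fun C2 => Fdev w s C1 C2) with hG
  calc _ ≤ Ex (pw p M1) (fun C1 => Real.exp (l * G C1) * Real.exp (M2 * (l * (2 / M2)) ^ 2)) := by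
        refine Ex_mono (pw_isPmf hp M1) fun C1 _ => ?_
        rw [← Real.exp_add]
        have := mgf_pw hq (l * (2 / M2)) h2 M2 (fun C2 => l * Fdev w s C1 C2)
          (fun C2 m b => hscale (hd2 C1 C2 m b))
        rwa [Ex_const_mul] at this
    _ ≤ Real.exp (l * Ex (pw p M1) G + M1 * (l * (2 / M1)) ^ 2)
          * Real.exp (M2 * (l * (2 / M2)) ^ 2) := by
        rw [Ex_mul_const]
        apply mul_le_mul_of_nonneg_right _ (Real.exp_nonneg _)
        have := mgf_pw hp (l * (2 / M1)) h1 M1 (fun C1 => l * G C1)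
          (fun C1 m a => hscale (abs_Ex_sub_le (pw_isPmf hq M2) fun C2 => hd1 C1 C2 m a))
        rwa [Ex_const_mul] at this
    _ = _ := by rw [← Real.exp_add]

lemma tail_two {p : A → ℝ} {q : B → ℝ} (hp : IsPmf p) (hq : IsPmf q)
    (w : A → B → D → ℝ) (hw0 : ∀ a b d, 0 ≤ w a b d) (hw1 : ∀ a b, ∑ d, w a b d = 1)
    (s : D → ℝ) {M1 M2 : ℕ} (L : ℝ) (hL : 0 < L) (hM1 : L ≤ M1) (hM2 : L ≤ M2)
    (μ t : ℝ) (ht0 : 0 < t) (ht1 : t ≤ 1)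
    (hμ : Ex (pw p M1) (fun C1 => Ex (pw q M2) (fun C2 => Fdev w s C1 C2)) ≤ μ)
    (E : (Fin M1 → A) → (Fin M2 → B) → Prop) (hE : ∀ C1 C2, E C1 C2 → μ + t ≤ Fdev w s C1 C2) :
    Ex (pw p M1) (fun C1 => Ex (pw q M2) (fun C2 => if E C1 C2 then 1 else 0)) ≤
      Real.exp (-(t ^ 2 * L / 32)) := by
  have hM1r : (0:ℝ) < M1 := hL.trans_le hM1
  have hM2r : (0:ℝ) < M2 := hL.trans_le hM2
  set l := t * L / 16 with hl
  have hl0 : 0 < l := by positivity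
  have aux : ∀ M : ℝ, L ≤ M → l * (2 / M) ≤ 1 ∧ M * (l * (2 / M)) ^ 2 ≤ t ^ 2 * L / 64 := by
    intro M hM
    have hM0 : 0 < M := hL.trans_le hM
    constructor
    · rw [← mul_div_assoc, div_le_one hM0, hl]
      nlinarith
    · have : M * (l * (2 / M)) ^ 2 = (t ^ 2 * L / 64) * (L / M) := by
        rw [hl]; field_simp; ring
      rw [this]
      exact mul_le_of_le_one_right (by positivity) ((div_le_one hM0).2 hM)
  have hm := mgf_two hp hq w hw0 hw1 s (by exact_mod_cast hM1r) (by exact_mod_cast hM2r) l hl0.le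
    (aux _ hM1).1 (aux _ hM2).1
  calc _ ≤ Ex (pw p M1) (fun C1 => Ex (pw q M2) (fun C2 =>
          Real.exp (-(l * (μ + t))) * Real.exp (l * Fdev w s C1 C2))) := by
        refine Ex_mono (pw_isPmf hp _) fun C1 _ => Ex_mono (pw_isPmf hq _) fun C2 _ => ?_
        rw [← Real.exp_add]
        split_ifs with h
        · apply Real.one_le_exp
          have := mul_le_mul_of_nonneg_left (hE C1 C2 h) hl0.le
          linarith
        · positivity
    _ = Real.exp (-(l * (μ + t))) * Ex (pw p M1) (fun C1 => Ex (pw q M2) (fun C2 =>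
          Real.exp (l * Fdev w s C1 C2))) := by
        simp only [Ex_const_mul]
    _ ≤ _ := by
        refine (mul_le_mul_of_nonneg_left hm (Real.exp_nonneg _)).trans ?_
        rw [← Real.exp_add]
        apply Real.exp_le_exp.2
        have h1 := (aux _ hM1).2
        have h2 := (aux _ hM2).2
        have h3 := mul_le_mul_of_nonneg_left hμ hl0.le
        have h4 : l * t = t ^ 2 * L / 16 := by rw [hl]; ring
        linarith

lemma mean_two {p : A → ℝ} {q : B → ℝ} (hp : IsPmf p) (hq : IsPmf q)
    (w : A → B → D → ℝ) (hw0 : ∀ a b d, 0 ≤ w a b d) (hw1 : ∀ a b, ∑ d, w a b d = 1)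
    (r : B → D → ℝ) (hr : ∀ b d, r b d = Ex p (fun a => w a b d))
    (s : D → ℝ) (hs : ∀ d, s d = Ex q (fun b => r b d))
    (T1 : A → B → D → Prop) (T2 : B → D → Prop) (K1 K2 : ℝ) (hK1 : 0 ≤ K1) (hK2 : 0 ≤ K2)
    (hT1 : ∀ a b d, T1 a b d → p a ≠ 0 → w a b d ≤ K1 * r b d)
    (hT2 : ∀ b d, T2 b d → q b ≠ 0 → r b d ≤ K2 * s d)
    {M1 M2 : ℕ} (hM1 : 0 < M1) (hM2 : 0 < M2) :
    Ex (pw p M1) (fun C1 => Ex (pw q M2) (fun C2 => Fdev w s C1 C2)) ≤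
      (Real.sqrt (K1 / M1)
        + 2 * Ex p (fun a => Ex q (fun b => ∑ d, w a b d * if T1 a b d then 0 else 1)))
      + (Real.sqrt (K2 / M2)
        + 2 * Ex p (fun a => Ex q (fun b => ∑ d, w a b d * if T2 b d then 0 else 1))) := by
  have hM2r : (0:ℝ) < M2 := by exact_mod_cast hM2
  have hr0 : ∀ b d, 0 ≤ r b d := fun b d => by rw [hr]; exact Ex_nonneg hp fun a => hw0 _ _ _
  have hr1 : ∀ b, ∑ d, r b d = 1 := fun b => by
    simp only [hr]; rw [← Ex_sum]; simp only [hw1]; exact Ex_const hp 1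
  have hs1 : ∑ d, s d = 1 := by
    simp only [hs]; rw [← Ex_sum]; simp only [hr1]; exact Ex_const hq 1
  have htri : ∀ (C1 : Fin M1 → A) (C2 : Fin M2 → B), Fdev w s C1 C2 ≤
      (∑ d, |(M1:ℝ)⁻¹ * ∑ m1, ((M2:ℝ)⁻¹ * ∑ m2, w (C1 m1) (C2 m2) d)
        - (M2:ℝ)⁻¹ * ∑ m2, r (C2 m2) d|)
      + ∑ d, |(M2:ℝ)⁻¹ * ∑ m2, r (C2 m2) d - s d| := by
    intro C1 C2
    rw [← Finset.sum_add_distrib]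
    exact Finset.sum_le_sum fun d _ => abs_sub_le _ _ _
  refine (Ex_mono (pw_isPmf hp M1) fun C1 _ =>
    Ex_mono (pw_isPmf hq M2) fun C2 _ => htri C1 C2).trans ?_
  simp only [Ex_add]
  refine add_le_add ?_ ?_
  · rw [Ex_comm]
    have hstep : ∀ C2 : Fin M2 → B, Ex (pw p M1) (fun C1 =>
        ∑ d, |(M1:ℝ)⁻¹ * ∑ m1, ((M2:ℝ)⁻¹ * ∑ m2, w (C1 m1) (C2 m2) d)
        - (M2:ℝ)⁻¹ * ∑ m2, r (C2 m2) d|) ≤ Real.sqrt (K1 / M1) + 2 * ((M2:ℝ)⁻¹ * ∑ m2,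
          (fun b => Ex p (fun a => ∑ d, w a b d * if T1 a b d then 0 else 1)) (C2 m2)) := by
      intro C2
      have hv : ∀ d, Ex p (fun a => (M2:ℝ)⁻¹ * ∑ m2, w a (C2 m2) d)
          = (M2:ℝ)⁻¹ * ∑ m2, r (C2 m2) d := by
        intro d
        rw [Ex_const_mul, Ex_sum]
        simp only [hr]
      have := cover hp (fun a d => (M2:ℝ)⁻¹ * ∑ m2, w a (C2 m2) d)
        (fun a d => (M2:ℝ)⁻¹ * ∑ m2, w a (C2 m2) d * if T1 a (C2 m2) d then 1 else 0)
        (fun a d => mul_nonneg (by positivity) (Finset.sum_nonneg fun i _ =>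
          mul_nonneg (hw0 _ _ _) (by split_ifs <;> norm_num)))
        (fun a d => mul_le_mul_of_nonneg_left (Finset.sum_le_sum fun i _ =>
          mul_le_of_le_one_right (hw0 _ _ _) (by split_ifs <;> norm_num)) (by positivity))
        K1 hK1 (by
          intro a d ha
          simp only [hv]
          rw [mul_left_comm, Finset.mul_sum (f := fun m2 => r (C2 m2) d)]
          refine mul_le_mul_of_nonneg_left (Finset.sum_le_sum fun i _ => ?_) (by positivity)
          split_ifs with h
          · rw [mul_one]; exact hT1 _ _ _ h ha
          · rw [mul_zero]; exact mul_nonneg hK1 (hr0 _ _)) M1 hM1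
      simp only [hv] at this
      rw [avg_sum_one hM2 (fun m2 d => r (C2 m2) d) (fun m2 => hr1 _), mul_one] at this
      refine this.trans (le_of_eq ?_)
      congr 2
      simp only
      rw [← Ex_sum, ← Ex_const_mul]
      congr 1
      funext a
      rw [Finset.sum_comm, Finset.mul_sum]
      refine Finset.sum_congr rfl fun d _ => ?_
      rw [← mul_sub, ← Finset.sum_sub_distrib]
      congr 1
      refine Finset.sum_congr rfl fun i _ => ?_
      split_ifs <;> ring
    refine (Ex_mono (pw_isPmf hq M2) fun C2 _ => hstep C2).trans (le_of_eq ?_)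
    rw [Ex_add, Ex_const (pw_isPmf hq M2), Ex_const_mul, Ex_const_mul, Ex_sum]
    simp only [Ex_pw_eval hq M2 _
      (fun b => Ex p (fun a => ∑ d, w a b d * if T1 a b d then 0 else 1))]
    rw [Ex_comm q p]
    simp
    field_simp
  · rw [Ex_const (pw_isPmf hp M1)]
    have := cover hq r (fun b d => r b d * if T2 b d then 1 else 0)
      (fun b d => mul_nonneg (hr0 _ _) (by split_ifs <;> norm_num))
      (fun b d => mul_le_of_le_one_right (hr0 _ _) (by split_ifs <;> norm_num)) K2 hK2 (by
        intro b d hb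
        rw [← hs]
        split_ifs with h
        · rw [mul_one]; exact hT2 _ _ h hb
        · rw [mul_zero, hs]; exact mul_nonneg hK2 (Ex_nonneg hq fun b => hr0 _ _)) M2 hM2
    simp only [← hs] at this
    rw [hs1, mul_one] at this
    refine this.trans (le_of_eq ?_)
    congr 2
    rw [Ex_comm]
    congr 1
    funext b
    rw [Ex_sum]
    refine Finset.sum_congr rfl fun d _ => ?_
    rw [Ex_mul_const, ← hr]
    split_ifs <;> ring

end OneShot

section ChannelLemmas

variable {X Y Z : Type} [Fintype X] [Fintype Y] [Fintype Z] (P : Channel X Y Z)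

lemma qX_pmf : IsPmf P.qX := ⟨P.qX_nonneg, P.qX_sum_one⟩
lemma qY_pmf : IsPmf P.qY := ⟨P.qY_nonneg, P.qY_sum_one⟩

def J (t : X × Y × Z) : ℝ := P.joint t.1 t.2.1 t.2.2

lemma sum_J (f : X → Y → Z → ℝ) : Ex (J P) (fun t => f t.1 t.2.1 t.2.2)
    = ∑ x, ∑ y, ∑ z, P.joint x y z * f x y z := by
  simp only [Ex, J, Fintype.sum_prod_type]

lemma J_pmf : IsPmf (J P) := by
  constructor
  · rintro ⟨x, y, z⟩
    exact mul_nonneg (mul_nonneg (P.qX_nonneg x) (P.qY_nonneg y)) (P.W_nonneg x y z)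
  · simp [J, Fintype.sum_prod_type, Channel.joint, ← Finset.mul_sum, P.W_sum_one, P.qX_sum_one,
      P.qY_sum_one]

lemma prod_sum_fin {A : Type} [Fintype A] (n : ℕ) (f : Fin n → A → ℝ) :
    ∏ k, ∑ a, f k a = ∑ as : Fin n → A, ∏ k, f k (as k) := by
  rw [Finset.prod_univ_sum]; simp

lemma Wn_nonneg (n : ℕ) (xs : Fin n → X) (ys : Fin n → Y) (zs : Fin n → Z) :
    0 ≤ P.Wn n xs ys zs := Finset.prod_nonneg fun _ _ => P.W_nonneg _ _ _

lemma Wn_sum (n : ℕ) (xs : Fin n → X) (ys : Fin n → Y) : ∑ zs, P.Wn n xs ys zs = 1 := by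
  simp only [Channel.Wn]
  rw [← prod_sum_fin n (fun k z => P.W (xs k) (ys k) z)]
  simp [P.W_sum_one]

lemma qZgYn_eq (n : ℕ) (ys : Fin n → Y) (zs : Fin n → Z) :
    P.qZgYn n ys zs = Ex (pw P.qX n) (fun xs => P.Wn n xs ys zs) := by
  simp only [Channel.qZgYn, Channel.qZgY, Ex, pw, Channel.Wn, ← Finset.prod_mul_distrib]
  exact prod_sum_fin n (fun k x => P.qX x * P.W x (ys k) (zs k))

lemma qZ_eq (z : Z) : P.qZ z = ∑ y, P.qY y * P.qZgY y z := by
  simp only [Channel.qZ, Channel.qZgY, Channel.joint, Finset.mul_sum]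
  rw [Finset.sum_comm]
  exact Finset.sum_congr rfl fun y _ => Finset.sum_congr rfl fun x _ => by ring

lemma qZn_eq (n : ℕ) (zs : Fin n → Z) :
    P.qZn n zs = Ex (pw P.qY n) (fun ys => P.qZgYn n ys zs) := by
  simp only [Channel.qZgYn, Ex, pw, Channel.qZn, ← Finset.prod_mul_distrib, qZ_eq]
  exact prod_sum_fin n (fun k y => P.qY y * P.qZgY y (zs k))

lemma qZgY_nonneg (y : Y) (z : Z) : 0 ≤ P.qZgY y z :=
  Finset.sum_nonneg fun x _ => mul_nonneg (P.qX_nonneg x) (P.W_nonneg x y z)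

lemma qZ_nonneg (z : Z) : 0 ≤ P.qZ z := by
  rw [qZ_eq]
  exact Finset.sum_nonneg fun y _ => mul_nonneg (P.qY_nonneg y) (qZgY_nonneg P y z)

lemma qZgY_pos {x : X} {y : Y} {z : Z} (hx : P.qX x ≠ 0) (hw : P.W x y z ≠ 0) :
    0 < P.qZgY y z := by
  have h1 : 0 < P.qX x * P.W x y z :=
    mul_pos ((P.qX_nonneg x).lt_of_ne' hx) ((P.W_nonneg x y z).lt_of_ne' hw)
  exact h1.trans_le (Finset.single_le_sum (f := fun x => P.qX x * P.W x y z)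
    (fun x _ => mul_nonneg (P.qX_nonneg x) (P.W_nonneg x y z)) (Finset.mem_univ x))

lemma qZ_pos {y : Y} {z : Z} (hy : P.qY y ≠ 0) (hw : P.qZgY y z ≠ 0) : 0 < P.qZ z := by
  have h1 : 0 < P.qY y * P.qZgY y z :=
    mul_pos ((P.qY_nonneg y).lt_of_ne' hy) ((qZgY_nonneg P y z).lt_of_ne' hw)
  rw [qZ_eq]
  exact h1.trans_le (Finset.single_le_sum (f := fun y => P.qY y * P.qZgY y z)
    (fun y _ => mul_nonneg (P.qY_nonneg y) (qZgY_nonneg P y z)) (Finset.mem_univ y))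

lemma prod_le_exp (n : ℕ) (u v : Fin n → ℝ) (hu : ∀ k, 0 ≤ u k) (hv : ∀ k, 0 ≤ v k)
    (h : ∀ k, u k ≠ 0 → 0 < v k) (c : ℝ) (hc : ∑ k, Real.log (u k / v k) ≤ c) :
    ∏ k, u k ≤ Real.exp c * ∏ k, v k := by
  by_cases h0 : ∀ k, u k ≠ 0
  · have : ∏ k, u k = Real.exp (∑ k, Real.log (u k / v k)) * ∏ k, v k := by
      rw [Real.exp_sum, ← Finset.prod_mul_distrib]
      refine Finset.prod_congr rfl fun k _ => ?_
      have hvk := h k (h0 k)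
      rw [Real.exp_log (div_pos ((hu k).lt_of_ne' (h0 k)) hvk)]
      field_simp
    rw [this]
    exact mul_le_mul_of_nonneg_right (Real.exp_le_exp.2 hc) (Finset.prod_nonneg fun k _ => hv k)
  · push Not at h0
    obtain ⟨k, hk⟩ := h0
    rw [Finset.prod_eq_zero (Finset.mem_univ k) hk]
    exact mul_nonneg (Real.exp_nonneg _) (Finset.prod_nonneg fun k _ => hv k)

lemma log_ratio_bound {c u v : ℝ} (hc : 0 ≤ c) (hu : 0 ≤ u) (hv : 0 ≤ v)
    (h : c ≠ 0 → u ≠ 0 → 0 < v) : c * (u - v) ≤ c * (u * Real.log (u / v)) := by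
  by_cases hc0 : c = 0
  · simp [hc0]
  by_cases hu0 : u = 0
  · subst hu0; simp; positivity
  have hv' := h hc0 hu0
  have hu' : 0 < u := hu.lt_of_ne' hu0
  apply mul_le_mul_of_nonneg_left _ hc
  have := Real.one_sub_inv_le_log_of_pos (div_pos hu' hv')
  have h2 := mul_le_mul_of_nonneg_left this hu
  refine le_trans (le_of_eq ?_) h2
  field_simp

lemma qZgY_sum (y : Y) : ∑ z, P.qZgY y z = 1 := by
  simp only [Channel.qZgY]
  rw [Finset.sum_comm]
  simp [← Finset.mul_sum, P.W_sum_one, P.qX_sum_one]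

lemma qZ_sum : ∑ z, P.qZ z = 1 := by
  simp only [qZ_eq]
  rw [Finset.sum_comm]
  simp [← Finset.mul_sum, qZgY_sum, P.qY_sum_one]

lemma IXZgY_nonneg : 0 ≤ P.IXZgY := by
  have h : ∑ x, ∑ y, ∑ z, (P.qX x * P.qY y) * (P.W x y z - P.qZgY y z) ≤ P.IXZgY := by
    refine Finset.sum_le_sum fun x _ => Finset.sum_le_sum fun y _ => Finset.sum_le_sum fun z _ => ?_
    rw [Channel.joint, Channel.iXZgY, mul_assoc (P.qX x * P.qY y)]
    refine log_ratio_bound (mul_nonneg (P.qX_nonneg x) (P.qY_nonneg y)) (P.W_nonneg x y z)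
      (qZgY_nonneg P y z) fun hc hw => qZgY_pos P (left_ne_zero_of_mul hc) hw
  simpa [← Finset.mul_sum, Finset.sum_sub_distrib, P.W_sum_one, qZgY_sum] using h

lemma IYZ_nonneg : 0 ≤ P.IYZ := by
  have e : P.IYZ = ∑ y, ∑ z, P.qY y * (P.qZgY y z * Real.log (P.qZgY y z / P.qZ z)) := by
    simp only [Channel.IYZ, Channel.joint, Channel.iYZ]
    rw [Finset.sum_comm]
    refine Finset.sum_congr rfl fun y _ => ?_
    rw [Finset.sum_comm]
    refine Finset.sum_congr rfl fun z _ => ?_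
    rw [← Finset.sum_mul, ← mul_assoc]
    congr 1
    simp only [Channel.qZgY, Finset.mul_sum]
    exact Finset.sum_congr rfl fun x _ => by ring
  have h : ∑ y, ∑ z, P.qY y * (P.qZgY y z - P.qZ z) ≤ P.IYZ := by
    rw [e]
    refine Finset.sum_le_sum fun y _ => Finset.sum_le_sum fun z _ => ?_
    exact log_ratio_bound (P.qY_nonneg y) (qZgY_nonneg P y z) (qZ_nonneg P z)
      fun hc hw => qZ_pos P hc hw
  simpa [← Finset.mul_sum, Finset.sum_sub_distrib, qZ_sum, qZgY_sum] using h

lemma Ex_joint (n : ℕ) (g : (Fin n → X) → (Fin n → Y) → (Fin n → Z) → ℝ) :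
    Ex (pw P.qX n) (fun xs => Ex (pw P.qY n) (fun ys => ∑ zs, P.Wn n xs ys zs * g xs ys zs)) =
    Ex (pw (J P) n) (fun a => g (fun k => (a k).1) (fun k => (a k).2.1) (fun k => (a k).2.2)) := by
  simp only [Ex, Finset.mul_sum]
  have : ∀ F : (Fin n → X) → (Fin n → Y) → (Fin n → Z) → ℝ,
      ∑ xs, ∑ ys, ∑ zs, F xs ys zs = ∑ t : (Fin n → X) × (Fin n → Y) × (Fin n → Z),
        F t.1 t.2.1 t.2.2 := by
    intro F; simp only [Fintype.sum_prod_type]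
  rw [this]
  let e : (Fin n → X × Y × Z) ≃ (Fin n → X) × (Fin n → Y) × (Fin n → Z) :=
    { toFun := fun a => (fun k => (a k).1, fun k => (a k).2.1, fun k => (a k).2.2)
      invFun := fun t k => (t.1 k, t.2.1 k, t.2.2 k)
      left_inv := fun a => rfl
      right_inv := fun t => rfl }
  refine (Fintype.sum_equiv e _ _ fun a => ?_).symm
  simp only [e, Equiv.coe_fn_mk, pw, J, Channel.joint, Channel.Wn, Finset.prod_mul_distrib]
  ring

lemma tv_le (n : ℕ) (R1 R2 : ℝ) {M1 M2 : ℕ} (hM1 : 0 < M1) (hM2 : 0 < M2)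
    (h1 : Real.exp (n * R1) ≤ M1) (h2 : Real.exp (n * R2) ≤ M2) (v : ℝ) (hv : v ≤ 1)
    (h1' : (M1:ℝ) * Real.exp (-(n * R1)) ≤ 1 + v) (h2' : (M2:ℝ) * Real.exp (-(n * R2)) ≤ 1 + v)
    (C1 : Fin M1 → Fin n → X) (C2 : Fin M2 → Fin n → Y) :
    tvDist (fun zs => P.pOut n R1 R2 C1 C2 zs) (fun zs => P.qZn n zs) ≤
      (1 / 2) * (3 * v + Fdev (P.Wn n) (P.qZn n) C1 C2) := by
  have hM1r : (0:ℝ) < M1 := by exact_mod_cast hM1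
  have hM2r : (0:ℝ) < M2 := by exact_mod_cast hM2
  set k1 := (M1:ℝ) * Real.exp (-(n * R1)) with hk1
  set k2 := (M2:ℝ) * Real.exp (-(n * R2)) with hk2
  have hk1' : 1 ≤ k1 := by
    have := mul_le_mul_of_nonneg_right h1 (Real.exp_nonneg (-(n * R1)))
    rwa [← Real.exp_add, add_neg_cancel, Real.exp_zero] at this
  have hk2' : 1 ≤ k2 := by
    have := mul_le_mul_of_nonneg_right h2 (Real.exp_nonneg (-(n * R2)))
    rwa [← Real.exp_add, add_neg_cancel, Real.exp_zero] at this
  set pb : (Fin n → Z) → ℝ := fun zs =>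
    (M1:ℝ)⁻¹ * ∑ m1, ((M2:ℝ)⁻¹ * ∑ m2, P.Wn n (C1 m1) (C2 m2) zs) with hpb
  have hpb0 : ∀ zs, 0 ≤ pb zs := fun zs => mul_nonneg (by positivity) (Finset.sum_nonneg fun _ _ =>
    mul_nonneg (by positivity) (Finset.sum_nonneg fun _ _ => Wn_nonneg P n _ _ _))
  have hpb1 : ∑ zs, pb zs = 1 :=
    avg_sum_one hM1 (fun m1 zs => (M2:ℝ)⁻¹ * ∑ m2, P.Wn n (C1 m1) (C2 m2) zs) fun m1 =>
      avg_sum_one hM2 (fun m2 zs => P.Wn n (C1 m1) (C2 m2) zs) fun m2 => Wn_sum P n _ _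
  have hp : ∀ zs, P.pOut n R1 R2 C1 C2 zs = k1 * k2 * pb zs := by
    intro zs
    simp only [Channel.pOut, hpb, hk1, hk2, ← Finset.mul_sum]
    rw [mul_add, neg_add, Real.exp_add]
    field_simp
  have hkk : 1 ≤ k1 * k2 := one_le_mul_of_one_le_of_one_le hk1' hk2'
  have hkk' : k1 * k2 - 1 ≤ 3 * v := by nlinarith
  unfold tvDist
  apply mul_le_mul_of_nonneg_left _ (by norm_num)
  calc _ ≤ ∑ zs, ((k1 * k2 - 1) * pb zs + |pb zs - P.qZn n zs|) := by
        refine Finset.sum_le_sum fun zs _ => ?_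
        simp only [hp]
        have : k1 * k2 * pb zs - P.qZn n zs = (k1 * k2 - 1) * pb zs + (pb zs - P.qZn n zs) := by ring
        rw [this]
        refine (abs_add_le _ _).trans ?_
        rw [abs_of_nonneg (mul_nonneg (by linarith) (hpb0 zs))]
    _ = (k1 * k2 - 1) + Fdev (P.Wn n) (P.qZn n) C1 C2 := by
        rw [Finset.sum_add_distrib, ← Finset.mul_sum, hpb1, mul_one]; rfl
    _ ≤ _ := by linarith

lemma numCw_bounds (n : ℕ) (R δ : ℝ) (h : δ ≤ R) :
    0 < numCw n R ∧ Real.exp (n * R) ≤ numCw n R ∧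
      (numCw n R : ℝ) * Real.exp (-(n * R)) ≤ 1 + Real.exp (-(δ * n)) := by
  have hp := Real.exp_pos (n * R)
  refine ⟨Nat.ceil_pos.2 hp, Nat.le_ceil _, ?_⟩
  have h1 : (numCw n R : ℝ) ≤ Real.exp (n * R) + 1 := (Nat.ceil_lt_add_one hp.le).le
  refine (mul_le_mul_of_nonneg_right h1 (Real.exp_nonneg _)).trans ?_
  rw [add_mul, ← Real.exp_add, add_neg_cancel, Real.exp_zero, one_mul]
  rw [mul_comm δ]
  gcongr

lemma sqrt_bound (n : ℕ) (I R ε δ : ℝ) (M : ℕ) (hM : Real.exp (n * R) ≤ M)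
    (h : 2 * δ ≤ R - I - ε) :
    Real.sqrt (Real.exp (n * (I + ε)) / M) ≤ Real.exp (-(δ * n)) := by
  apply Real.sqrt_le_iff.2
  refine ⟨Real.exp_nonneg _, ?_⟩
  have h1 : Real.exp (n * (I + ε)) / M ≤ Real.exp (n * (I + ε)) / Real.exp (n * R) := by
    gcongr
  refine h1.trans ?_
  rw [← Real.exp_sub, ← Real.exp_nat_mul]
  apply Real.exp_le_exp.2
  push_cast
  have : (0:ℝ) ≤ n := Nat.cast_nonneg n
  nlinarith

end ChannelLemmas

/-- Theorem 3: if `R1 > I(X;Z|Y)` and `R2 > I(Y;Z)`, then there exist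
`γ1, γ2 > 0` such that for all sufficiently large `n`, the probability (over the random
codebooks of block length `n` and rates `R1`, `R2`) that the variational distance between
the induced output distribution and `q_{Z^n}` exceeds `exp (-γ1 n)` is at most
`exp (-exp (γ2 n))`. -/
theorem statement0 {X Y Z : Type} [Fintype X] [Fintype Y] [Fintype Z]
    (P : Channel X Y Z) (R1 R2 : ℝ) (hR1 : P.IXZgY < R1) (hR2 : P.IYZ < R2) :
    ∃ γ1 > (0 : ℝ), ∃ γ2 > (0 : ℝ), ∃ N : ℕ, ∀ n ≥ N,
      P.cbP2 n (numCw n R1) (numCw n R2) (fun C1 C2 =>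
          tvDist (fun zs => P.pOut n R1 R2 C1 C2 zs) (fun zs => P.qZn n zs) >
            Real.exp (-(γ1 * (n : ℝ))))
        ≤ Real.exp (-Real.exp (γ2 * (n : ℝ))) := by
  have hI1 := IXZgY_nonneg P
  have hI2 := IYZ_nonneg P
  obtain ⟨δ1, hδ1, hc1⟩ := chernoff (J_pmf P) (fun t => P.iXZgY t.1 t.2.1 t.2.2)
    (ε := (R1 - P.IXZgY) / 2) (by linarith)
  obtain ⟨δ2, hδ2, hc2⟩ := chernoff (J_pmf P) (fun t => P.iYZ t.2.1 t.2.2)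
    (ε := (R2 - P.IYZ) / 2) (by linarith)
  rw [sum_J P P.iXZgY] at hc1
  rw [sum_J P (fun _ y z => P.iYZ y z)] at hc2
  change ∀ n : ℕ, Ex _ (fun a => if _ ≤ (n:ℝ) * (P.IXZgY + _) then (0:ℝ) else 1) ≤ _ at hc1
  change ∀ n : ℕ, Ex _ (fun a => if _ ≤ (n:ℝ) * (P.IYZ + _) then (0:ℝ) else 1) ≤ _ at hc2
  set ε1 := (R1 - P.IXZgY) / 2 with hε1
  set ε2 := (R2 - P.IYZ) / 2 with hε2
  obtain ⟨δ, hδ, d1, d2, d3, d4, d5, d6⟩ : ∃ δ > (0:ℝ), δ ≤ δ1 ∧ δ ≤ δ2 ∧ 2 * δ ≤ ε1 ∧ 2 * δ ≤ ε2 ∧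
      4 * δ ≤ R1 ∧ 4 * δ ≤ R2 := by
    refine ⟨min (min δ1 δ2) (min (min (ε1 / 2) (ε2 / 2)) (min (R1 / 4) (R2 / 4))), ?_, ?_⟩
    · have : 0 < ε1 := by rw [hε1]; linarith
      have : 0 < ε2 := by rw [hε2]; linarith
      have : 0 < R1 := by linarith
      have : 0 < R2 := by linarith
      show 0 < min (min δ1 δ2) (min (min (ε1 / 2) (ε2 / 2)) (min (R1 / 4) (R2 / 4)))
      positivity
    · set m := min (min δ1 δ2) (min (min (ε1 / 2) (ε2 / 2)) (min (R1 / 4) (R2 / 4))) with hm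
      have := le_refl m
      rw [hm, le_min_iff, le_min_iff, le_min_iff, le_min_iff, le_min_iff, ← hm] at this
      obtain ⟨⟨a, b⟩, ⟨c, d⟩, e, f⟩ := this
      refine ⟨a, b, ?_, ?_, ?_, ?_⟩ <;> linarith
  obtain ⟨N, hN⟩ := exists_nat_ge (100 / δ)
  refine ⟨δ / 2, by positivity, δ, hδ, N, fun n hn => ?_⟩
  have hnδ : 100 ≤ δ * n := by
    have : 100 / δ ≤ n := hN.trans (by exact_mod_cast hn)
    rw [div_le_iff₀ hδ] at this
    linarith
  obtain ⟨hM1, hM1a, hM1b⟩ := numCw_bounds n R1 δ (by linarith)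
  obtain ⟨hM2, hM2a, hM2b⟩ := numCw_bounds n R2 δ (by linarith)
  generalize numCw n R1 = M1 at *
  generalize numCw n R2 = M2 at *
  set v := Real.exp (-(δ * n)) with hv
  have hv0 : 0 < v := Real.exp_pos _
  have hv1 : v ≤ 1 := by rw [hv]; apply Real.exp_le_one_iff.2; linarith
  have hmean := mean_two (pw_isPmf (qX_pmf P) n) (pw_isPmf (qY_pmf P) n) (P.Wn n) (Wn_nonneg P n)
    (Wn_sum P n) (P.qZgYn n) (qZgYn_eq P n) (P.qZn n) (qZn_eq P n)
    (fun xs ys zs => ∑ k, P.iXZgY (xs k) (ys k) (zs k) ≤ (n:ℝ) * (P.IXZgY + ε1))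
    (fun ys zs => ∑ k, P.iYZ (ys k) (zs k) ≤ (n:ℝ) * (P.IYZ + ε2))
    (Real.exp (n * (P.IXZgY + ε1))) (Real.exp (n * (P.IYZ + ε2)))
    (Real.exp_nonneg _) (Real.exp_nonneg _)
    (fun xs ys zs hT hx => prod_le_exp n (fun k => P.W (xs k) (ys k) (zs k))
      (fun k => P.qZgY (ys k) (zs k)) (fun k => P.W_nonneg _ _ _) (fun k => qZgY_nonneg P _ _)
      (fun k hk => qZgY_pos P ((pw_pos_iff n xs).1 hx k) hk) _ hT)
    (fun ys zs hT hy => prod_le_exp n (fun k => P.qZgY (ys k) (zs k))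
      (fun k => P.qZ (zs k)) (fun k => qZgY_nonneg P _ _) (fun k => qZ_nonneg P _)
      (fun k hk => qZ_pos P ((pw_pos_iff n ys).1 hy k) hk) _ hT) hM1 hM2
  rw [Ex_joint P n (fun xs ys zs => if ∑ k, P.iXZgY (xs k) (ys k) (zs k) ≤
      (n:ℝ) * (P.IXZgY + ε1) then 0 else 1),
    Ex_joint P n (fun xs ys zs => if ∑ k, P.iYZ (ys k) (zs k) ≤
      (n:ℝ) * (P.IYZ + ε2) then 0 else 1)] at hmean
  have hdn : ∀ δ', δ ≤ δ' → Real.exp (-(δ' * n)) ≤ v := fun δ' h => by rw [hv]; gcongr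
  have b1 := (hc1 n).trans (hdn _ d1)
  have b2 := (hc2 n).trans (hdn _ d2)
  have s1 := sqrt_bound n P.IXZgY R1 ε1 δ M1 hM1a (by linarith)
  have s2 := sqrt_bound n P.IYZ R2 ε2 δ M2 hM2a (by linarith)
  have hmean' : Ex (pw (pw P.qX n) M1) (fun C1 => Ex (pw (pw P.qY n) M2)
      (fun C2 => Fdev (P.Wn n) (P.qZn n) C1 C2)) ≤ 6 * v := by
    refine hmean.trans ?_
    rw [← hv] at s1 s2
    linarith
  have hn0 : (0:ℝ) ≤ n := Nat.cast_nonneg n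
  have htail := tail_two (pw_isPmf (qX_pmf P) n) (pw_isPmf (qY_pmf P) n) (P.Wn n) (Wn_nonneg P n)
    (Wn_sum P n) (P.qZn n) (Real.exp (n * (4 * δ))) (Real.exp_pos _)
    (le_trans (by gcongr) hM1a) (le_trans (by gcongr) hM2a) (6 * v) v hv0 hv1 hmean'
    (fun C1 C2 => tvDist (fun zs => P.pOut n R1 R2 C1 C2 zs) (fun zs => P.qZn n zs) >
            Real.exp (-(δ / 2 * (n : ℝ)))) (by
      intro C1 C2 hE
      by_contra hlt
      push Not at hlt
      have h1 := tv_le P n R1 R2 hM1 hM2 hM1a hM2a v hv1 hM1b hM2b C1 C2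
      have h2 : 5 * v ≤ Real.exp (-(δ / 2 * (n : ℝ))) := by
        have e1 : v = Real.exp (-(δ / 2 * n)) * Real.exp (-(δ / 2 * n)) := by
          rw [hv, ← Real.exp_add]; ring_nf
        have e2 : Real.exp (-(δ / 2 * n)) ≤ 1 / 5 := by
          rw [Real.exp_neg, one_div]
          apply inv_anti₀ (by norm_num)
          linarith [Real.add_one_le_exp (δ / 2 * n)]
        rw [e1]
        nlinarith [Real.exp_pos (-(δ / 2 * n))]
      linarith)
  refine le_trans (le_of_eq ?_) (htail.trans ?_)
  · simp only [Channel.cbP2, Ex, pw, Finset.mul_sum]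
    refine Finset.sum_congr rfl fun C1 _ => Finset.sum_congr rfl fun C2 _ => ?_
    rw [mul_assoc]
  · apply Real.exp_le_exp.2
    apply neg_le_neg
    have e : v ^ 2 * Real.exp (n * (4 * δ)) = Real.exp (δ * n) * Real.exp (δ * n) := by
      rw [hv, ← Real.exp_nat_mul, ← Real.exp_add, ← Real.exp_add]; push_cast; ring_nf
    rw [e]
    have := Real.add_one_le_exp (δ * n)
    nlinarith

end MACResolvability
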